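/- Let u and f₂ be smooth real-valued functions of coordinates including (x, y, t, t₂, z₂). Define A₂ = λ u_x + u_t and B₂ = −λ u_y − f₂ − u_{z₂}, polynomials in λ ∈ ℝ with smooth coefficients. Then the Zakharov–Shabat type equation λ ∂_{z₂} A₂ − ∂_{t₂} B₂ + {A₂, B₂} = −λ² ∂_y A₂ − λ² ∂_x B₂ holds for every λ ∈ ℝ if and only if the following three equations hold: (i) u_{t z₂} + u_{y t₂} + u_{xy} u_{x z₂} + u_{xy} f_{2,x} + u_{xy} u_{ty} − f_{2,y} u_{xx} − u_{yy} u_{tx} − u_{y z₂} u_{xx} = 0; (ii) f_{2,t₂} + u_{z₂ t₂} + f_{2,x} u_{ty} + u_{x z₂} u_{ty} − f_{2,y} u_{tx} − u_{y z₂} u_{tx} = 0; (iii) f_{2,x} − u_{ty} + u_{xx} u_{yy} − u_{xy}² = 0. -/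

import Mathlib

/-- Partial derivative of `f` in the `i`-th coordinate direction. -/
noncomputable def pd {n : ℕ} (i : Fin n) (f : (Fin n → ℝ) → ℝ) : (Fin n → ℝ) → ℝ :=
  fun p => fderiv ℝ f p (Pi.single i 1)

/-- Coordinates: x = 0, y = 1, t = 2, t₂ = 3, z₂ = 4.  `A₂ = λ u_x + u_t`. -/
noncomputable def A2 (u : (Fin 5 → ℝ) → ℝ) (lam : ℝ) : (Fin 5 → ℝ) → ℝ :=
  fun q => lam * pd 0 u q + pd 2 u q

/-- `B₂ = −λ u_y − f₂ − u_{z₂}`. -/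
noncomputable def B2 (u f2 : (Fin 5 → ℝ) → ℝ) (lam : ℝ) : (Fin 5 → ℝ) → ℝ :=
  fun q => -lam * pd 1 u q - f2 q - pd 4 u q

theorem ContDiff.pd {n : ℕ} {f : (Fin n → ℝ) → ℝ} (hf : ContDiff ℝ (⊤ : ℕ∞) f) (i : Fin n) :
    ContDiff ℝ (⊤ : ℕ∞) (_root_.pd i f) :=
  (hf.fderiv_right (m := (⊤ : ℕ∞)) (by simp)).clm_apply contDiff_const

/-- Symmetry of second partial derivatives. -/
theorem pd_comm {n : ℕ} {f : (Fin n → ℝ) → ℝ} (hf : ContDiff ℝ (⊤ : ℕ∞) f) (i j : Fin n)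
    (q : Fin n → ℝ) : pd i (pd j f) q = pd j (pd i f) q := by
  have hd : DifferentiableAt ℝ (fderiv ℝ f) q :=
    (hf.fderiv_right (m := (⊤ : ℕ∞)) (by simp)).differentiable (by simp) q
  have hpd (k l : Fin n) : pd k (pd l f) q
      = fderiv ℝ (fderiv ℝ f) q (Pi.single k 1) (Pi.single l 1) := by
    have h := hd.hasFDerivAt.clm_apply (hasFDerivAt_const (Pi.single l (1 : ℝ)) q)
    change fderiv ℝ (fun p => fderiv ℝ f p (Pi.single l 1)) q (Pi.single k 1) = _
    rw [h.fderiv]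
    simp
  have hs : IsSymmSndFDerivAt ℝ f q :=
    (hf.of_le (m := 2) (WithTop.coe_le_coe.2 (le_top : (2 : ℕ∞) ≤ ⊤))).contDiffAt.isSymmSndFDerivAt
      (by simp)
  rw [hpd, hpd]
  exact hs _ _

theorem pd_A2 {u : (Fin 5 → ℝ) → ℝ} (hu : ContDiff ℝ (⊤ : ℕ∞) u) (lam : ℝ) (i : Fin 5)
    (q : Fin 5 → ℝ) : pd i (A2 u lam) q = lam * pd i (pd 0 u) q + pd i (pd 2 u) q := by
  have hd (j : Fin 5) : HasFDerivAt (pd j u) (fderiv ℝ (pd j u) q) q :=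
    ((hu.pd j).differentiable (by simp) q).hasFDerivAt
  have h : HasFDerivAt (A2 u lam) _ q := ((hd 0).const_mul lam).add (hd 2)
  change fderiv ℝ (A2 u lam) q (Pi.single i 1) = _
  rw [h.fderiv]
  simp [pd]

theorem pd_B2 {u f2 : (Fin 5 → ℝ) → ℝ} (hu : ContDiff ℝ (⊤ : ℕ∞) u)
    (hf2 : ContDiff ℝ (⊤ : ℕ∞) f2) (lam : ℝ) (i : Fin 5) (q : Fin 5 → ℝ) :
    pd i (B2 u f2 lam) q = -lam * pd i (pd 1 u) q - pd i f2 q - pd i (pd 4 u) q := by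
  have hd (j : Fin 5) : HasFDerivAt (pd j u) (fderiv ℝ (pd j u) q) q :=
    ((hu.pd j).differentiable (by simp) q).hasFDerivAt
  have hf := (hf2.differentiable (by simp) q).hasFDerivAt
  have h : HasFDerivAt (B2 u f2 lam) _ q := (((hd 1).const_mul (-lam)).sub hf).sub (hd 4)
  change fderiv ℝ (B2 u f2 lam) q (Pi.single i 1) = _
  rw [h.fderiv]
  simp [pd]

theorem quadratic_eq_zero_iff_coeffs {a b c : ℝ} :
    (∀ x : ℝ, a + x * b - x ^ 2 * c = 0) ↔ b = 0 ∧ a = 0 ∧ c = 0 := by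
  constructor
  · intro h
    have h0 := h 0
    have h1 := h 1
    have h2 := h (-1)
    refine ⟨?_, ?_, ?_⟩ <;> linarith
  · rintro ⟨rfl, rfl, rfl⟩ x
    simp

/-- the Zakharov–Shabat type equation
`λ ∂_{z₂} A₂ − ∂_{t₂} B₂ + {A₂, B₂} = −λ² ∂_y A₂ − λ² ∂_x B₂` holds for every `λ ∈ ℝ`
iff the three flow equations (i), (ii), (iii) hold. -/
theorem stmt14 (u f2 : (Fin 5 → ℝ) → ℝ) (hu : ContDiff ℝ (⊤ : ℕ∞) u)
    (hf2 : ContDiff ℝ (⊤ : ℕ∞) f2) :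
    (∀ lam : ℝ, ∀ q : Fin 5 → ℝ,
        lam * pd 4 (A2 u lam) q - pd 3 (B2 u f2 lam) q
            + (pd 0 (A2 u lam) q * pd 1 (B2 u f2 lam) q
              - pd 1 (A2 u lam) q * pd 0 (B2 u f2 lam) q)
          = -lam ^ 2 * pd 1 (A2 u lam) q - lam ^ 2 * pd 0 (B2 u f2 lam) q)
    ↔ ((∀ q, pd 2 (pd 4 u) q + pd 1 (pd 3 u) q
            + pd 0 (pd 1 u) q * pd 0 (pd 4 u) q + pd 0 (pd 1 u) q * pd 0 f2 q
            + pd 0 (pd 1 u) q * pd 2 (pd 1 u) q - pd 1 f2 q * pd 0 (pd 0 u) q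
            - pd 1 (pd 1 u) q * pd 2 (pd 0 u) q - pd 1 (pd 4 u) q * pd 0 (pd 0 u) q = 0)
        ∧ (∀ q, pd 3 f2 q + pd 3 (pd 4 u) q
            + pd 0 f2 q * pd 2 (pd 1 u) q + pd 0 (pd 4 u) q * pd 2 (pd 1 u) q
            - pd 1 f2 q * pd 2 (pd 0 u) q - pd 1 (pd 4 u) q * pd 2 (pd 0 u) q = 0)
        ∧ (∀ q, pd 0 f2 q - pd 2 (pd 1 u) q
            + pd 0 (pd 0 u) q * pd 1 (pd 1 u) q - pd 0 (pd 1 u) q ^ 2 = 0)) := by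
  rw [forall_comm, ← forall_and, ← forall_and]
  refine forall_congr' fun q => ?_
  rw [← quadratic_eq_zero_iff_coeffs]
  refine forall_congr' fun lam => ?_
  rw [← sub_eq_zero]
  simp only [pd_A2 hu, pd_B2 hu hf2, pd_comm hu 4 0, pd_comm hu 4 2, pd_comm hu 3 1,
    pd_comm hu 1 0, pd_comm hu 0 2, pd_comm hu 1 2]
  refine Eq.congr ?_ rfl
  ring
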